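/- Suppose ℓ = ℓ(n) = O(n) and 0 ≤ m = m(n) ≤ C(n,2). With p = p(n) := m/C(n,2), as n → ∞, q(ℓ; n, m) ∼ (1 − p/2)^ℓ · exp( −(ℓ/n)² · p(1−p)/(2−p)² ), i.e. the ratio of the two sides tends to 1. -/

import Mathlib

open Filter Real

/-- Edges of the complete graph on `Fin n`: ordered pairs `(u,v)` with `u < v`. -/
abbrev Edge (n : ℕ) : Type := {e : Fin n × Fin n // e.1 < e.2}

/-- A configuration of the random edge-orientation model: for each pair `u < v`,
`none` means no edge, `some true` means the directed edge `u → v`, and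
`some false` means the directed edge `v → u`. -/
abbrev Config (n : ℕ) : Type := Edge n → Option Bool

/-- The directed edge relation determined by a configuration. -/
def DirEdge {n : ℕ} (f : Config n) (u v : Fin n) : Prop :=
  (∃ h : u < v, f ⟨(u, v), h⟩ = some true) ∨ (∃ h : v < u, f ⟨(v, u), h⟩ = some false)

/-- `Reaches f u v`: the configuration `f` contains a directed path from `u` to `v`
(paths of length `0` are allowed, so `Reaches f u u` always holds). -/
def Reaches {n : ℕ} (f : Config n) (u v : Fin n) : Prop :=
  Relation.ReflTransGen (DirEdge f) u v

/-- The probability of an event under a weight function on a finite sample space. -/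
noncomputable def prWeight {α : Type*} [Fintype α] (w : α → ℝ) (E : Set α) : ℝ :=
  ∑ x, E.indicator w x

/-- The weight of one edge state in `⃗G(n,p)`: no edge has probability `1 - p`
and each of the two orientations has probability `p/2`. -/
noncomputable def edgeWeight (p : ℝ) : Option Bool → ℝ
  | none => 1 - p
  | some _ => p / 2

/-- The probability of an event in the random directed graph `⃗G(n,p)`. -/
noncomputable def PrGnp (n : ℕ) (p : ℝ) (E : Set (Config n)) : ℝ :=
  prWeight (fun f => ∏ e : Edge n, edgeWeight p (f e)) E

/-- The number of present edges of a configuration. -/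
def edgeCount {n : ℕ} (f : Config n) : ℕ :=
  (Finset.univ.filter fun e : Edge n => (f e).isSome).card

/-- The probability of an event in the random directed graph `⃗G(n,m)`:
the underlying graph is uniform among the graphs with exactly `m` edges, and each
present edge is oriented in one of its two directions with probability `1/2`,
independently over edges. -/
noncomputable def PrGnm (n m : ℕ) (E : Set (Config n)) : ℝ :=
  prWeight (fun f => if edgeCount f = m
      then ((Nat.choose (Nat.choose n 2) m : ℝ) * 2 ^ m)⁻¹ else 0) E

open Polynomial in
/-- Three-term recurrence for the coefficients of `(1 + X) ^ k * (1 + 2 X) ^ (N - k)`. -/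
theorem coeff_one_add_X_pow_mul_recurrence (N m k : ℕ) (hk : k + 1 ≤ N) :
    2 * ((N : ℝ) - k) * ((1 + X : ℝ[X]) ^ (k + 1) * (1 + 2 * X) ^ (N - (k + 1))).coeff m =
      (2 * N - m - 3 * k) * ((1 + X : ℝ[X]) ^ k * (1 + 2 * X) ^ (N - k)).coeff m +
      k * ((1 + X : ℝ[X]) ^ (k - 1) * (1 + 2 * X) ^ (N - (k - 1))).coeff m := by
  have hder : ∀ P : ℝ[X], (X * derivative P).coeff m = m * P.coeff m := by
    intro P
    cases m with
    | zero => simp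
    | succ m => rw [coeff_X_mul, coeff_derivative]; push_cast; ring
  suffices h : C (2 * ((N : ℝ) - k)) * ((1 + X : ℝ[X]) ^ (k + 1) * (1 + 2 * X) ^ (N - (k + 1))) =
      C (2 * (N : ℝ) - 3 * k) * ((1 + X : ℝ[X]) ^ k * (1 + 2 * X) ^ (N - k)) +
      C (k : ℝ) * ((1 + X : ℝ[X]) ^ (k - 1) * (1 + 2 * X) ^ (N - (k - 1))) -
      X * derivative ((1 + X : ℝ[X]) ^ k * (1 + 2 * X) ^ (N - k)) by
    have h' := congrArg (fun P => coeff P m) h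
    simp only [coeff_add, coeff_sub, coeff_C_mul, hder] at h'
    linear_combination h'
  obtain ⟨j, rfl⟩ := Nat.exists_eq_add_of_le hk
  rcases k with _ | k
  · have e1 : 0 + 1 + j - (0 + 1) = j := by omega
    have e2 : 0 + 1 + j - 0 = j + 1 := by omega
    simp only [e1, e2, derivative_mul, derivative_pow, derivative_add, derivative_one,
      derivative_X, derivative_ofNat]
    simp only [map_sub, map_mul, map_natCast, map_ofNat, Nat.add_sub_cancel]
    push_cast
    ring
  · have e1 : k + 1 + 1 + j - (k + 1 + 1) = j := by omega
    have e2 : k + 1 + 1 + j - (k + 1) = j + 1 := by omega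
    have e3 : k + 1 + 1 + j - (k + 1 - 1) = j + 2 := by omega
    simp only [e1, e2, e3, derivative_mul, derivative_pow, derivative_add, derivative_one,
      derivative_X, derivative_ofNat]
    simp only [map_sub, map_mul, map_natCast, map_ofNat, Nat.add_sub_cancel]
    push_cast
    ring

theorem card_edge (n : ℕ) : Fintype.card (Edge n) = n.choose 2 := by
  let φ : Edge n ≃ Σ j : Fin n, Fin j :=
    { toFun := fun e => ⟨e.1.2, ⟨e.1.1, e.2⟩⟩
      invFun := fun x => ⟨(⟨x.2, x.2.2.trans x.1.2⟩, x.1), x.2.2⟩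
      left_inv := fun _ => rfl
      right_inv := fun _ => rfl }
  rw [Fintype.card_congr φ, Fintype.card_sigma]
  simp only [Fintype.card_fin]
  rw [Fin.sum_univ_eq_sum_range (fun i => i) n, Finset.sum_range_id, Nat.choose_two_right]

open Polynomial in
/-- Generating function, by number of edges, of the configurations avoiding a family of
directed edges. -/
theorem sum_avoiding_X_pow_edgeCount {n : ℕ} (F : Finset (Edge n)) (o : Edge n → Bool) :
    (∑ f : Config n, Set.indicator {f : Config n | ∀ e ∈ F, f e ≠ some (o e)}
      (fun f => (X : ℝ[X]) ^ edgeCount f) f) =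
      (1 + X) ^ F.card * (1 + 2 * X) ^ (n.choose 2 - F.card) := by
  classical
  let w : Edge n → Option Bool → ℝ[X] := fun e s =>
    if e ∈ F ∧ s = some (o e) then 0 else if s.isSome then X else 1
  have hw : ∀ f : Config n, Set.indicator {f : Config n | ∀ e ∈ F, f e ≠ some (o e)}
      (fun f => (X : ℝ[X]) ^ edgeCount f) f = ∏ e, w e (f e) := by
    intro f
    by_cases h : ∀ e ∈ F, f e ≠ some (o e)
    · rw [Set.indicator_of_mem (by exact h)]
      have : ∀ e, w e (f e) = if (f e).isSome then X else 1 := fun e =>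
        if_neg fun he => h e he.1 he.2
      simp only [this, Finset.prod_ite, Finset.prod_const, one_pow, mul_one]
      rfl
    · rw [Set.indicator_of_notMem (by exact h)]
      push Not at h
      obtain ⟨e, he, hfe⟩ := h
      have hwe : w e (f e) = 0 := if_pos ⟨he, hfe⟩
      exact (Finset.prod_eq_zero (Finset.mem_univ e) hwe).symm
  have hs : ∀ e, ∑ s, w e s = if e ∈ F then 1 + X else 1 + 2 * X := by
    intro e
    rw [Fintype.sum_option, Fintype.sum_bool]
    by_cases he : e ∈ F <;> cases ho : o e <;> simp [w, he, ho, two_mul]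
  rw [Finset.sum_congr rfl fun f _ => hw f, ← Fintype.prod_sum, Finset.prod_congr rfl fun e _ => hs e,
    Finset.prod_ite, Finset.prod_const, Finset.prod_const]
  have h1 : (Finset.univ.filter fun e => e ∈ F) = F := by ext; simp
  have h2 : (Finset.univ.filter fun e => e ∉ F) = Fᶜ := by ext; simp
  rw [h1, h2, Finset.card_compl, card_edge]

open Polynomial in
theorem PrGnm_avoiding_eq_coeff {n : ℕ} (m : ℕ) (F : Finset (Edge n)) (o : Edge n → Bool) :
    PrGnm n m {f | ∀ e ∈ F, f e ≠ some (o e)} =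
      ((1 + X : ℝ[X]) ^ F.card * (1 + 2 * X) ^ (n.choose 2 - F.card)).coeff m /
        ((Nat.choose (Nat.choose n 2) m : ℝ) * 2 ^ m) := by
  classical
  rw [← sum_avoiding_X_pow_edgeCount F o, finsetSum_coeff, Finset.sum_div, PrGnm, prWeight]
  refine Finset.sum_congr rfl fun f _ => ?_
  by_cases h : f ∈ {f : Config n | ∀ e ∈ F, f e ≠ some (o e)}
  · rw [Set.indicator_of_mem h, Set.indicator_of_mem h, coeff_X_pow]
    by_cases hf : edgeCount f = m
    · simp [hf]
    · simp [hf, Ne.symm hf]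
  · rw [Set.indicator_of_notMem h, Set.indicator_of_notMem h, coeff_zero, zero_div]

open Polynomial in
theorem coeff_one_add_two_mul_X_pow (N m : ℕ) :
    ((1 + 2 * X : ℝ[X]) ^ N).coeff m = (N.choose m : ℝ) * 2 ^ m := by
  have h : (1 + 2 * X : ℝ[X]) ^ N = ((1 + X : ℝ[X]) ^ N).comp (C 2 * X) := by
    simp only [pow_comp, add_comp, one_comp, X_comp, C_ofNat]
  rw [h, comp_C_mul_X_coeff, coeff_one_add_X_pow]

/-- One step of the perturbed fixed-point iteration for consecutive ratios. -/
theorem ratio_step {p t r r' : ℝ} (hp0 : 0 ≤ p) (hp1 : p ≤ 1) (ht0 : 0 ≤ t) (ht : t ≤ 1 / 8)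
    (hr : 1 / 4 ≤ r) (hrs : |r - (1 - p / 2)| ≤ 2 * t)
    (hr' : (1 - t) * r' = 1 - p / 2 - 3 / 2 * t + t / (2 * r)) :
    1 / 4 ≤ r' ∧ |r' - (1 - p / 2)| ≤ 2 * t ∧
      |log (r' / (1 - p / 2)) + t * (p * (1 - p) / (2 - p) ^ 2)| ≤ 100 * t ^ 2 := by
  obtain ⟨s, hs⟩ : ∃ s, s = 1 - p / 2 := ⟨_, rfl⟩
  obtain rfl : p = 2 - 2 * s := by linarith
  rw [← hs] at hrs hr' ⊢
  have hs1 : s ≤ 1 := by linarith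
  have hs2 : 1 / 2 ≤ s := by linarith
  have hs0 : 0 < s := by linarith
  have hr0 : 0 < r := by linarith
  obtain ⟨u, hu⟩ : ∃ u, u = 1 / (2 * r) := ⟨_, rfl⟩
  have hu0 : 0 < u := by rw [hu]; positivity
  have hu2 : u ≤ 2 := by
    rw [hu, div_le_iff₀ (by positivity)]; linarith
  have htu : t / (2 * r) = t * u := by rw [hu]; ring
  rw [htu] at hr'
  have hdiff : (1 - t) * (r' - s) = t * (s - 3 / 2 + u) := by linarith
  have hlow : s - 2 * t ≤ r' := by
    have : 0 ≤ (1 - t) * (r' - s + 2 * t) := by nlinarith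
    have := nonneg_of_mul_nonneg_right this (by linarith)
    linarith
  have hup : r' ≤ s + 2 * t := by
    have : 0 ≤ (1 - t) * (s + 2 * t - r') := by nlinarith
    have := nonneg_of_mul_nonneg_right this (by linarith)
    linarith
  have hr'4 : 1 / 4 ≤ r' := by linarith
  refine ⟨hr'4, abs_le.2 ⟨by linarith, by linarith⟩, ?_⟩
  obtain ⟨κ, hκ⟩ : ∃ κ, κ = (2 - 2 * s) * (1 - (2 - 2 * s)) / (2 - (2 - 2 * s)) ^ 2 := ⟨_, rfl⟩
  rw [← hκ]
  have hκs : s * κ = 3 / 2 - s - 1 / (2 * s) := by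
    rw [hκ, show 2 - (2 - 2 * s) = 2 * s by ring]; field_simp; ring
  have hsinv : 1 / (2 * s) ≤ 1 := by rw [div_le_iff₀ (by positivity)]; linarith
  have hsinv0 : 0 ≤ 1 / (2 * s) := by positivity
  obtain ⟨v, hv⟩ : ∃ v, v = 1 / (2 * s) := ⟨_, rfl⟩
  rw [← hv] at hκs hsinv hsinv0
  have huv : u - v = 2 * u * v * (s - r) := by rw [hu, hv]; field_simp
  have huv' : |u - v| ≤ 8 * t := by
    rw [huv, abs_mul, abs_of_nonneg (by positivity), abs_sub_comm]
    have : 2 * u * v ≤ 4 := by nlinarith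
    calc 2 * u * v * |r - s| ≤ 4 * (2 * t) := by gcongr
      _ = 8 * t := by ring
  rw [abs_le] at huv'
  have hmain : (1 - t) * (r' - s + t * (s * κ)) = t * (u - v - t * (s * κ)) := by
    rw [hκs]; linear_combination hdiff
  have hsκ0 : |s * κ| ≤ 1 := by rw [hκs, abs_le]; constructor <;> linarith
  rw [abs_le] at hsκ0
  have hb1 : r' - s + t * (s * κ) ≤ 12 * t ^ 2 := by
    have h1 : t * (u - v - t * (s * κ)) ≤ t * (9 * t) := by
      apply mul_le_mul_of_nonneg_left _ ht0; nlinarith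
    by_contra! h
    nlinarith [mul_lt_mul_of_pos_left h (show 0 < 1 - t by linarith), sq_nonneg t]
  have hb2 : -(12 * t ^ 2) ≤ r' - s + t * (s * κ) := by
    have h1 : t * (-(9 * t)) ≤ t * (u - v - t * (s * κ)) := by
      apply mul_le_mul_of_nonneg_left _ ht0; nlinarith
    by_contra! h
    nlinarith [mul_lt_mul_of_pos_left h (show 0 < 1 - t by linarith), sq_nonneg t]
  obtain ⟨y, hy⟩ : ∃ y, y = r' / s := ⟨_, rfl⟩
  have hys : r' = y * s := by rw [hy]; field_simp
  rw [← hy]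
  rw [hys] at hb1 hb2 hlow hup hr'4
  have hy4 : 1 / 4 ≤ y := by
    by_contra! h
    linarith [mul_lt_mul_of_pos_right h hs0]
  have hy0 : 0 < y := by linarith
  have hdouble : ∀ a b : ℝ, 0 ≤ b → a * s ≤ b → a ≤ 2 * b := by
    intro a b hb hab
    by_contra! h
    nlinarith only [hab, hb, hs2, mul_lt_mul_of_pos_right h hs0, mul_nonneg hb (sub_nonneg.2 hs2)]
  have hB1 : y - 1 + t * κ ≤ 2 * (12 * t ^ 2) :=
    hdouble _ _ (by positivity) (by linarith)
  have hB2 : -(y - 1 + t * κ) ≤ 2 * (12 * t ^ 2) :=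
    hdouble _ _ (by positivity) (by linarith)
  have hy1 : (y - 1) ^ 2 ≤ (2 * (2 * t)) ^ 2 :=
    sq_le_sq' (neg_le.1 (hdouble _ _ (by positivity) (by linarith)))
      (hdouble _ _ (by positivity) (by linarith))
  have hlog1 := log_le_sub_one_of_pos hy0
  have hlog2 := one_sub_inv_le_log_of_pos hy0
  have hinv : 1 - y⁻¹ = (y - 1) - (y - 1) ^ 2 * y⁻¹ := by field_simp; ring
  have hyinv : y⁻¹ ≤ 4 := by
    rw [inv_le_comm₀ hy0 (by norm_num)]; linarith
  have hquad : (y - 1) ^ 2 * y⁻¹ ≤ (2 * (2 * t)) ^ 2 * 4 := by gcongr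
  have ht2 := sq_nonneg t
  rw [abs_le]
  constructor <;> linarith

/-- Solutions of the three-term recurrence are log-close to `s ^ k * exp (-κ k (k - 1) / (2 N))`
with `s = 1 - p / 2` and `κ = p (1 - p) / (2 - p) ^ 2`. -/
theorem recurrence_log_estimate {p N : ℝ} (hp0 : 0 ≤ p) (hp1 : p ≤ 1) (hN : 0 < N) (L : ℕ)
    (hL : 8 * (L : ℝ) ≤ N) (c : ℕ → ℝ) (hc0 : 0 < c 0)
    (hrec : ∀ k < L, 2 * (N - k) * c (k + 1) =
      (2 * N - p * N - 3 * k) * c k + k * c (k - 1)) :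
    0 < c L ∧ |log (c L / c 0 / (1 - p / 2) ^ L) +
      L * (L - 1) / (2 * N) * (p * (1 - p) / (2 - p) ^ 2)| ≤ 100 * L * (L / N) ^ 2 := by
  obtain ⟨κ, hκ⟩ : ∃ κ, κ = p * (1 - p) / (2 - p) ^ 2 := ⟨_, rfl⟩
  have hs0 : 0 < 1 - p / 2 := by linarith
  have key : ∀ k < L, 0 < c k ∧ 1 / 4 ≤ c (k + 1) / c k ∧
      |c (k + 1) / c k - (1 - p / 2)| ≤ 2 * (k / N) ∧
      |log (c (k + 1) / c k / (1 - p / 2)) + k / N * (p * (1 - p) / (2 - p) ^ 2)| ≤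
        100 * (k / N) ^ 2 := by
    intro k
    induction k with
    | zero =>
      intro h
      have h1 := hrec 0 h
      have h2 : c (0 + 1) / c 0 = 1 - p / 2 := by
        rw [div_eq_iff hc0.ne']
        apply mul_left_cancel₀ hN.ne'
        simp only [Nat.cast_zero] at h1
        linarith
      rw [h2, div_self hs0.ne']
      refine ⟨hc0, by linarith, by simp, by simp⟩
    | succ k ih =>
      intro h
      obtain ⟨hk0, hk1, hk2, -⟩ := ih (by omega)
      have hkL : ((k + 1 : ℕ) : ℝ) ≤ L := by exact_mod_cast h.le
      have hpos : 0 < c (k + 1) := by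
        have : 0 < c (k + 1) / c k := by linarith
        exact (div_pos_iff_of_pos_right hk0).1 this
      have ht : ((k + 1 : ℕ) : ℝ) / N ≤ 1 / 8 := by
        rw [div_le_iff₀ hN]; linarith
      refine ⟨hpos, ratio_step hp0 hp1 (by positivity) ht hk1 (hk2.trans ?_) ?_⟩
      · push_cast
        gcongr
        linarith
      · have h1 := hrec (k + 1) h
        rw [Nat.add_sub_cancel] at h1
        field_simp
        linear_combination h1
  have step : ∀ k ≤ L, 0 < c k ∧ |log (c k / c 0 / (1 - p / 2) ^ k) +
      k * (k - 1) / (2 * N) * κ| ≤ 100 * k * (L / N) ^ 2 := by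
    intro k
    induction k with
    | zero => intro _; simp [hc0, hc0.ne']
    | succ k ih =>
      intro h
      obtain ⟨h0, h1⟩ := ih (by omega)
      obtain ⟨-, h2, -, h3⟩ := key k (by omega)
      have hratio : 0 < c (k + 1) / c k := by linarith
      refine ⟨(div_pos_iff_of_pos_right h0).1 hratio, ?_⟩
      have hsplit : c (k + 1) / c 0 / (1 - p / 2) ^ (k + 1) =
          (c k / c 0 / (1 - p / 2) ^ k) * (c (k + 1) / c k / (1 - p / 2)) := by
        rw [pow_succ]
        generalize 1 - p / 2 = s at hs0 ⊢
        field_simp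
      rw [hsplit, log_mul (by positivity) (by positivity)]
      rw [← hκ] at h3
      have hkL : (k : ℝ) ≤ L := by exact_mod_cast (by omega : k ≤ L)
      have h4 : 100 * ((k : ℝ) / N) ^ 2 ≤ 100 * (L / N) ^ 2 := by gcongr
      have hring : log (c k / c 0 / (1 - p / 2) ^ k) + log (c (k + 1) / c k / (1 - p / 2)) +
          ((k + 1 : ℕ) : ℝ) * (((k + 1 : ℕ) : ℝ) - 1) / (2 * N) * κ =
          (log (c k / c 0 / (1 - p / 2) ^ k) + k * (k - 1) / (2 * N) * κ) +
          (log (c (k + 1) / c k / (1 - p / 2)) + k / N * κ) := by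
        push_cast; field_simp; ring
      rw [hring]
      refine (abs_add_le _ _).trans ?_
      push_cast
      linarith
  rw [← hκ]
  exact step L le_rfl

open Polynomial in
/-- Quantitative form of the asymptotics of the avoidance probability. -/
theorem exists_PrGnm_avoiding_eq_exp {n m : ℕ} {C : ℝ} (hn : 2 ≤ n) (hC : 0 ≤ C)
    (hCn : 32 * C ≤ n) (hm : m ≤ n.choose 2) (F : Finset (Edge n)) (hF : (F.card : ℝ) ≤ C * n)
    (o : Edge n → Bool) :
    ∃ ε : ℝ, |ε| ≤ (1600 * C ^ 3 + 2 * C * (1 + C)) / n ∧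
      PrGnm n m {f | ∀ e ∈ F, f e ≠ some (o e)} /
          ((1 - ((m : ℝ) / (Nat.choose n 2 : ℝ)) / 2) ^ F.card *
            Real.exp (-((F.card : ℝ) / (n : ℝ)) ^ 2 *
              (((m : ℝ) / (Nat.choose n 2 : ℝ)) *
                  (1 - (m : ℝ) / (Nat.choose n 2 : ℝ)) /
                (2 - (m : ℝ) / (Nat.choose n 2 : ℝ)) ^ 2))) = exp ε := by
  obtain ⟨L, hLdef⟩ : ∃ L, L = F.card := ⟨_, rfl⟩
  obtain ⟨N, hN⟩ : ∃ N : ℝ, N = (n.choose 2 : ℕ) := ⟨_, rfl⟩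
  obtain ⟨p, hp⟩ : ∃ p : ℝ, p = m / N := ⟨_, rfl⟩
  have hn2 : (2 : ℝ) ≤ n := by exact_mod_cast hn
  have hNn : N = n * (n - 1) / 2 := by rw [hN, Nat.cast_choose_two]
  have hN4 : (n : ℝ) ^ 2 / 4 ≤ N := by rw [hNn]; nlinarith
  have hn0 : (0 : ℝ) < n := by linarith
  have hN0 : 0 < N := lt_of_lt_of_le (by positivity) hN4
  have hmN : (m : ℝ) ≤ N := by rw [hN]; exact_mod_cast hm
  have hp0 : 0 ≤ p := by rw [hp]; positivity
  have hp1 : p ≤ 1 := by rw [hp, div_le_one hN0]; exact hmN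
  have hpN : p * N = m := by rw [hp]; field_simp
  rw [PrGnm_avoiding_eq_coeff, ← hN, ← hp, ← hLdef]
  rw [← hLdef] at hF
  have hL8 : 8 * (L : ℝ) ≤ N := by nlinarith
  let c : ℕ → ℝ := fun k => ((1 + X : ℝ[X]) ^ k * (1 + 2 * X) ^ (n.choose 2 - k)).coeff m
  have hc0 : c 0 = (Nat.choose (Nat.choose n 2) m : ℝ) * 2 ^ m := by
    simp only [c, pow_zero, one_mul, Nat.sub_zero, coeff_one_add_two_mul_X_pow]
  have hc0pos : 0 < c 0 := by
    rw [hc0]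
    have := Nat.choose_pos hm
    positivity
  obtain ⟨hcL, hlog⟩ := recurrence_log_estimate hp0 hp1 hN0 L hL8 c hc0pos (by
    intro k hk
    rw [hpN, hN]
    apply coeff_one_add_X_pow_mul_recurrence
    have h1 : (k : ℝ) + 1 ≤ L := by exact_mod_cast hk
    have h2 : ((k + 1 : ℕ) : ℝ) ≤ (n.choose 2 : ℕ) := by rw [← hN]; push_cast; linarith
    exact_mod_cast h2)
  rw [← hc0]
  change ∃ ε : ℝ, _ ∧ c L / c 0 / _ = _
  obtain ⟨κ, hκ⟩ : ∃ κ, κ = p * (1 - p) / (2 - p) ^ 2 := ⟨_, rfl⟩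
  rw [← hκ] at hlog ⊢
  have hκ0 : 0 ≤ κ := by
    rw [hκ]; exact div_nonneg (mul_nonneg hp0 (by linarith)) (sq_nonneg _)
  have hκ1 : κ ≤ 1 := by
    rw [hκ, div_le_one (by nlinarith)]; nlinarith
  have hs0 : 0 < 1 - p / 2 := by linarith
  refine ⟨log (c L / c 0 / (1 - p / 2) ^ L) + ((L : ℝ) / n) ^ 2 * κ, ?_, ?_⟩
  · have hsplit : log (c L / c 0 / (1 - p / 2) ^ L) + ((L : ℝ) / n) ^ 2 * κ =
        (log (c L / c 0 / (1 - p / 2) ^ L) + L * (L - 1) / (2 * N) * κ) +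
        (L : ℝ) * (n - L) / (n ^ 2 * (n - 1)) * κ := by
      have : (n : ℝ) - 1 ≠ 0 := by linarith
      rw [hNn]; field_simp; ring
    rw [hsplit]
    refine (abs_add_le _ _).trans ?_
    rw [add_div]
    refine add_le_add (hlog.trans ?_) ?_
    · have h1 : (L : ℝ) / N ≤ 4 * C / n := by
        rw [div_le_div_iff₀ hN0 hn0]; nlinarith
      calc 100 * (L : ℝ) * (L / N) ^ 2 ≤ 100 * (C * n) * (4 * C / n) ^ 2 := by gcongr
        _ = 1600 * C ^ 3 / n := by field_simp; ring
    · have hL0 : (0 : ℝ) ≤ L := by positivity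
      have h1 : |(n : ℝ) - L| ≤ (1 + C) * n := by
        rw [abs_le]; constructor <;> nlinarith
      have h2 : (n : ℝ) ^ 2 * (n / 2) ≤ n ^ 2 * (n - 1) := by gcongr; linarith
      rw [abs_mul, abs_div, abs_mul, abs_of_nonneg hL0, abs_of_nonneg hκ0,
        abs_of_nonneg (show (0 : ℝ) ≤ n ^ 2 * (n - 1) from le_trans (by positivity) h2)]
      calc (L : ℝ) * |(n : ℝ) - L| / (n ^ 2 * (n - 1)) * κ
          ≤ (C * n) * ((1 + C) * n) / (n ^ 2 * (n / 2)) * 1 := by gcongr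
        _ = 2 * C * (1 + C) / n := by field_simp
  · rw [Real.exp_add, Real.exp_log (by positivity), neg_mul, Real.exp_neg]
    field_simp

/-- Suppose `ℓ(n) = O(n)` and `0 ≤ m(n) ≤ C(n,2)`; let
`p(n) := m(n)/C(n,2)`. For any fixed family of `ℓ(n)` distinct unordered pairs,
each with a chosen orientation, the probability `q(ℓ;n,m)` that none of these
directed edges appears in `⃗G(n,m)` satisfies
`q(ℓ;n,m) ∼ (1 - p/2)^ℓ · exp(-(ℓ/n)² p(1-p)/(2-p)²)` as `n → ∞`. -/
theorem gnm_avoid_directed_edges_asymp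
    (ℓ m : ℕ → ℕ)
    (hℓ : ∃ C : ℝ, ∀ n : ℕ, 1 ≤ n → (ℓ n : ℝ) ≤ C * n)
    (hm : ∀ n, m n ≤ Nat.choose n 2)
    (F : (n : ℕ) → Finset (Edge n)) (hF : ∀ n, (F n).card = ℓ n)
    (o : (n : ℕ) → Edge n → Bool) :
    Filter.Tendsto (fun n : ℕ =>
        PrGnm n (m n) {f | ∀ e ∈ F n, f e ≠ some (o n e)} /
          ((1 - ((m n : ℝ) / (Nat.choose n 2 : ℝ)) / 2) ^ (ℓ n) *
            Real.exp (-((ℓ n : ℝ) / (n : ℝ)) ^ 2 *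
              (((m n : ℝ) / (Nat.choose n 2 : ℝ)) *
                  (1 - (m n : ℝ) / (Nat.choose n 2 : ℝ)) /
                (2 - (m n : ℝ) / (Nat.choose n 2 : ℝ)) ^ 2))))
      Filter.atTop (nhds 1) := by
  obtain ⟨C₀, hC₀⟩ := hℓ
  obtain ⟨C, hC0, hC⟩ : ∃ C : ℝ, 0 ≤ C ∧ ∀ n : ℕ, 1 ≤ n → (ℓ n : ℝ) ≤ C * n :=
    ⟨max C₀ 0, le_max_right _ _, fun n hn => (hC₀ n hn).trans (by gcongr; exact le_max_left _ _)⟩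
  have hex : ∀ n : ℕ, 2 ≤ n ∧ 32 * C ≤ n → _ := fun n hn =>
    exists_PrGnm_avoiding_eq_exp hn.1 hC0 hn.2 (hm n) (F n)
      ((hF n).symm ▸ hC n (by omega)) (o n)
  choose! ε hε hexp using hex
  have hev : ∀ᶠ n : ℕ in atTop, 2 ≤ n ∧ 32 * C ≤ n :=
    (eventually_ge_atTop 2).and (tendsto_natCast_atTop_atTop.eventually_ge_atTop (32 * C))
  have hε0 : Tendsto ε atTop (nhds 0) :=
    squeeze_zero_norm' (hev.mono hε) (tendsto_const_div_atTop_nhds_zero_nat _)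
  have hlim : Tendsto (fun n => Real.exp (ε n)) atTop (nhds 1) := by
    simpa [Function.comp_def] using (Real.continuous_exp.tendsto 0).comp hε0
  refine hlim.congr' (hev.mono fun n hn => ?_)
  rw [← hexp n hn, hF n]
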